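/- arXiv:1403.5194 — 4 statements merged into one kernel-verified Lean document; each statement's English description precedes it below -/
import Mathlib

section
/- Let (Ω,ℱ,P) be a probability space and X = (X_t)_{t∈[0,T]} an ℝⁿ-valued stochastic process with continuous sample paths. Let T_m ⊂ [0,T] be a finite set, and for each t ∈ T_m let ψ_t:ℝⁿ→[0,∞) be continuous and bounded. Let φ, φ̃:[0,T]→ℝⁿ be continuous with ψ_t(φ̃(t)) > 0 for all t ∈ T_m. For ε > 0, let A₁^ε, A₂^ε be measurable events with P(A₁^ε) > 0, P(A₂^ε) > 0, A₁^ε ⊆ {ω : sup_{t∈[0,T]}‖X_t(ω) − φ(t)‖ ≤ ε}, and A₂^ε ⊆ {ω : sup_{t∈[0,T]}‖X_t(ω) − φ̃(t)‖ ≤ ε}, and suppose P(A₁^ε)/P(A₂^ε) converges to a limit L ∈ ℝ as ε ↓ 0. Then, as ε ↓ 0, [P(A₁^ε)·∏_{t∈T_m} E[ψ_t(X_t) | A₁^ε]] / [P(A₂^ε)·∏_{t∈T_m} E[ψ_t(X_t) | A₂^ε]] → L·(∏_{t∈T_m} ψ_t(φ(t))) / (∏_{t∈T_m} ψ_t(φ̃(t)))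 -/
open MeasureTheory Set Filter

/-- If a random variable `Y` is within `ε` of a point `x` on the event `A ε` and `f` is continuous
at `x`, then the average of `f ∘ Y` over `A ε` converges to `f x` as `ε ↓ 0`. -/
theorem tendsto_setAverage_comp_of_norm_sub_le {Ω E F : Type*} [MeasurableSpace Ω]
    [SeminormedAddCommGroup E] [NormedAddCommGroup F] [NormedSpace ℝ F] [CompleteSpace F]
    {μ : Measure Ω} [IsFiniteMeasure μ] {Y : Ω → E} {f : E → F} {x : E} {A : ℝ → Set Ω}
    (hf : ContinuousAt f x) (hfY : AEStronglyMeasurable (fun ω => f (Y ω)) μ)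
    (hAm : ∀ ε > (0 : ℝ), MeasurableSet (A ε)) (hA0 : ∀ ε > (0 : ℝ), μ (A ε) ≠ 0)
    (hAY : ∀ ε > (0 : ℝ), ∀ ω ∈ A ε, ‖Y ω - x‖ ≤ ε) :
    Tendsto (fun ε => ⨍ ω in A ε, f (Y ω) ∂μ) (nhdsWithin 0 (Ioi 0)) (nhds (f x)) := by
  rw [Metric.nhds_basis_closedBall.tendsto_right_iff]
  intro δ hδ
  obtain ⟨r, hr, hball⟩ := Metric.eventually_nhds_iff.1
    (hf.eventually (Metric.closedBall_mem_nhds (f x) hδ))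
  filter_upwards [Ioo_mem_nhdsGT hr] with ε hε
  have hmem : ∀ᵐ ω ∂μ.restrict (A ε), f (Y ω) ∈ Metric.closedBall (f x) δ := by
    filter_upwards [ae_restrict_mem (hAm ε hε.1)] with ω hω
    refine hball ?_
    rw [dist_eq_norm]
    exact (hAY ε hε.1 ω hω).trans_lt hε.2
  refine (convex_closedBall (f x) δ).set_average_mem Metric.isClosed_closedBall
    (hA0 ε hε.1) (measure_ne_top μ _) hmem ?_
  refine Integrable.of_bound hfY.restrict (‖f x‖ + δ) ?_
  filter_upwards [hmem] with ω hω
  exact norm_le_of_mem_closedBall hω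

/-- Posterior tube-ratio theorem: if `A₁^ε, A₂^ε` are positive-probability events contained
in the `ε`-tubes around the continuous paths `φ, φ̃`, and the ratio of their probabilities
converges to `L` as `ε ↓ 0`, then the ratio weighted by the products of the conditional
expectations of the measurement likelihoods converges to
`L · ∏ ψ_t(φ(t)) / ∏ ψ_t(φ̃(t))`. -/
theorem posterior_tube_ratio {n : ℕ} {Ω : Type*} [MeasurableSpace Ω]
    (P : Measure Ω) [IsProbabilityMeasure P]
    (T : ℝ) (hT : 0 < T)
    (X : ℝ → Ω → EuclideanSpace ℝ (Fin n))
    (hXm : ∀ s, Measurable (X s))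
    (hXc : ∀ ω, ContinuousOn (fun s => X s ω) (Icc (0 : ℝ) T))
    (Tm : Finset ℝ) (hTm : (Tm : Set ℝ) ⊆ Icc (0 : ℝ) T)
    (ψ : ℝ → EuclideanSpace ℝ (Fin n) → ℝ)
    (hψc : ∀ s ∈ Tm, Continuous (ψ s))
    (hψb : ∀ s ∈ Tm, ∃ C, ∀ x, ψ s x ≤ C)
    (hψ0 : ∀ s ∈ Tm, ∀ x, 0 ≤ ψ s x)
    (φ φt : ℝ → EuclideanSpace ℝ (Fin n))
    (hφc : ContinuousOn φ (Icc (0 : ℝ) T)) (hφtc : ContinuousOn φt (Icc (0 : ℝ) T))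
    (hφtpos : ∀ s ∈ Tm, 0 < ψ s (φt s))
    (A₁ A₂ : ℝ → Set Ω)
    (hA₁m : ∀ ε > (0 : ℝ), MeasurableSet (A₁ ε))
    (hA₂m : ∀ ε > (0 : ℝ), MeasurableSet (A₂ ε))
    (hA₁pos : ∀ ε > (0 : ℝ), 0 < P (A₁ ε))
    (hA₂pos : ∀ ε > (0 : ℝ), 0 < P (A₂ ε))
    (hA₁sub : ∀ ε > (0 : ℝ), A₁ ε ⊆ {ω | ∀ s ∈ Icc (0 : ℝ) T, ‖X s ω - φ s‖ ≤ ε})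
    (hA₂sub : ∀ ε > (0 : ℝ), A₂ ε ⊆ {ω | ∀ s ∈ Icc (0 : ℝ) T, ‖X s ω - φt s‖ ≤ ε})
    (L : ℝ)
    (hL : Tendsto (fun ε => (P (A₁ ε)).toReal / (P (A₂ ε)).toReal)
      (nhdsWithin 0 (Ioi 0)) (nhds L)) :
    Tendsto
      (fun ε =>
        ((P (A₁ ε)).toReal *
            ∏ s ∈ Tm, ((P (A₁ ε)).toReal⁻¹ * ∫ ω in A₁ ε, ψ s (X s ω) ∂P)) /
          ((P (A₂ ε)).toReal *
            ∏ s ∈ Tm, ((P (A₂ ε)).toReal⁻¹ * ∫ ω in A₂ ε, ψ s (X s ω) ∂P)))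
      (nhdsWithin 0 (Ioi 0))
      (nhds (L * (∏ s ∈ Tm, ψ s (φ s)) / ∏ s ∈ Tm, ψ s (φt s))) := by
  have average_tendsto : ∀ (χ : ℝ → EuclideanSpace ℝ (Fin n)) (A : ℝ → Set Ω),
      (∀ ε > (0 : ℝ), MeasurableSet (A ε)) → (∀ ε > (0 : ℝ), 0 < P (A ε)) →
      (∀ ε > (0 : ℝ), A ε ⊆ {ω | ∀ s ∈ Icc (0 : ℝ) T, ‖X s ω - χ s‖ ≤ ε}) →
      Tendsto (fun ε => ∏ s ∈ Tm, ((P (A ε)).toReal⁻¹ * ∫ ω in A ε, ψ s (X s ω) ∂P))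
        (nhdsWithin 0 (Ioi 0)) (nhds (∏ s ∈ Tm, ψ s (χ s))) := by
    intro χ A hAm hApos hAsub
    refine tendsto_finsetProd Tm fun s hs => ?_
    have h := tendsto_setAverage_comp_of_norm_sub_le (hψc s hs).continuousAt
      ((hψc s hs).measurable.comp (hXm s)).aestronglyMeasurable hAm
      (fun ε hε => (hApos ε hε).ne') (fun ε hε ω hω => hAsub ε hε hω s (hTm hs))
    simpa only [setAverage_eq, smul_eq_mul, measureReal_def] using h
  have hne : ∏ s ∈ Tm, ψ s (φt s) ≠ 0 := Finset.prod_ne_zero_iff.2 fun s hs => (hφtpos s hs).ne'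
  rw [mul_div_assoc]
  simpa only [Pi.div_apply, mul_div_mul_comm] using
    hL.mul ((average_tendsto φ A₁ hA₁m hA₁pos hA₁sub).div
      (average_tendsto φt A₂ hA₂m hA₂pos hA₂sub) hne)
end

section
/- Let f:[0,T]×ℝⁿ→ℝⁿ be continuous and K-Lipschitz in its second argument uniformly in the first (‖f(t,a) − f(t,b)‖ ≤ K‖a − b‖ for all t ∈ [0,T], a,b ∈ ℝⁿ), and let G ∈ ℝ^{n×n} with operator norm ‖G‖. Let ε > 0, let w:[0,T]→ℝⁿ be continuous with w(0)=0, let x:[0,T]→ℝⁿ be continuous and satisfy x(t) = x(0) + ∫_0^t f(s, x(s)) ds + G·w(t) for all t ∈ [0,T], and let φ, η ∈ H with η(0) = 0 and φ̇(t) = f(t, φ(t)) + G·η̇(t) for a.e. t ∈ [0,T]. If ‖x(0) − φ(0)‖ ≤ ε and sup_{t∈[0,T]}‖w(t) − η(t)‖ ≤ ε, then sup_{t∈[0,T]}‖x(t) − φ(t)‖ ≤ (1 + ‖G‖)·e^{TK}·ε. (In particular, with c₁ := (1+‖G‖)e^{TK}, every ε-tube event around the initial state and noise path is contained in the c₁ε-tube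 event around the associated state path.) -/
open MeasureTheory Set Filter

noncomputable section

/-- `φ` belongs to the Cameron–Martin space `H` on `[0,T]`, with a.e. derivative `φ'`:
`φ` is absolutely continuous with (integrable) derivative `φ'` which is square integrable. -/
def IsCM {n : ℕ} (T : ℝ) (φ φ' : ℝ → EuclideanSpace ℝ (Fin n)) : Prop :=
  IntervalIntegrable φ' volume 0 T ∧
  (∀ t ∈ Icc (0 : ℝ) T, φ t = φ 0 + ∫ s in (0 : ℝ)..t, φ' s) ∧
  IntervalIntegrable (fun s => ‖φ' s‖ ^ 2) volume 0 T

/-- Square of the Cameron–Martin norm `‖φ‖_H² = ‖φ(0)‖² + ∫₀ᵀ ‖φ̇(t)‖² dt`. -/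
def cmNormSq {n : ℕ} (T : ℝ) (φ φ' : ℝ → EuclideanSpace ℝ (Fin n)) : ℝ :=
  ‖φ 0‖ ^ 2 + ∫ s in (0 : ℝ)..T, ‖φ' s‖ ^ 2

/-- Operator norm (induced by the Euclidean norm) of a matrix. -/
def matOpNorm {n : ℕ} (G : Matrix (Fin n) (Fin n) ℝ) : ℝ :=
  ‖(Matrix.toEuclideanLin G).toContinuousLinearMap‖

/-- **Grönwall's inequality**, integral form with constant coefficients. -/
theorem le_mul_exp_of_le_add_mul_integral {u : ℝ → ℝ} {a K T : ℝ} (hK : 0 ≤ K)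
    (hu : ContinuousOn u (Icc 0 T))
    (h : ∀ t ∈ Icc 0 T, u t ≤ a + K * ∫ s in (0 : ℝ)..t, u s) :
    ∀ t ∈ Icc 0 T, u t ≤ a * Real.exp (K * t) := by
  intro t ht
  have hT : 0 ≤ T := ht.1.trans ht.2
  set v : ℝ → ℝ := IccExtend hT ((Icc 0 T).domRestrict u)
  have hvc : Continuous v := hu.domRestrict.Icc_extend'
  have hvu : ∀ s ∈ Icc 0 T, v s = u s := fun s hs => IccExtend_of_mem hT _ hs
  have hint : ∀ r ∈ Icc 0 T, ∫ s in (0 : ℝ)..r, v s = ∫ s in (0 : ℝ)..r, u s := by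
    intro r hr
    refine intervalIntegral.integral_congr fun s hs => ?_
    rw [uIcc_of_le hr.1] at hs
    exact hvu s ⟨hs.1, hs.2.trans hr.2⟩
  have hd : ∀ r, HasDerivAt (fun r => a + K * ∫ s in (0 : ℝ)..r, v s) (K * v r) r := fun r =>
    ((hvc.integral_hasStrictDerivAt 0 r).hasDerivAt.const_mul K).const_add a
  have key := le_gronwallBound_of_liminf_deriv_right_le (δ := a) (K := K) (ε := 0) (a := 0) (b := T)
    (fun r _ => (hd r).continuousAt.continuousWithinAt)
    (fun r _ _ hr => (hd r).hasDerivWithinAt.liminf_right_slope_le hr) (by simp)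
    (fun r hr => by
      have hr' : r ∈ Icc 0 T := Ico_subset_Icc_self hr
      rw [add_zero, hint r hr', hvu r hr']
      exact mul_le_mul_of_nonneg_left (h r hr') hK) t ht
  rw [gronwallBound_ε0, sub_zero, hint t ht] at key
  exact (h t ht).trans key

theorem IsCM.continuousOn {n : ℕ} {T : ℝ} {φ φ' : ℝ → EuclideanSpace ℝ (Fin n)}
    (hT : 0 ≤ T) (hφ : IsCM T φ φ') : ContinuousOn φ (Icc 0 T) := by
  have h := intervalIntegral.continuousOn_primitive_interval' hφ.1 left_mem_uIcc
  rw [uIcc_of_le hT] at h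
  exact (continuousOn_const.add h).congr hφ.2.1

/-- Grönwall containment of noise tubes in state tubes: if `x` solves the integral
equation driven by the noise path `w` and `φ` solves the ODE driven by `η̇ ∈ L²`, and the
initial conditions and noise paths are within `ε` of each other, then the state paths are
within `(1 + ‖G‖)·e^{TK}·ε` of each other on `[0,T]`. -/
theorem noise_tube_subset_state_tube {n : ℕ} (T K : ℝ) (hT : 0 < T)
    (f : ℝ → EuclideanSpace ℝ (Fin n) → EuclideanSpace ℝ (Fin n))
    (hfc : Continuous fun p : ℝ × EuclideanSpace ℝ (Fin n) => f p.1 p.2)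
    (hLip : ∀ t ∈ Icc (0 : ℝ) T, ∀ a b : EuclideanSpace ℝ (Fin n),
      ‖f t a - f t b‖ ≤ K * ‖a - b‖)
    (G : Matrix (Fin n) (Fin n) ℝ)
    (ε : ℝ) (hε : 0 < ε)
    (w : ℝ → EuclideanSpace ℝ (Fin n))
    (hwc : ContinuousOn w (Icc (0 : ℝ) T)) (hw0 : w 0 = 0)
    (x : ℝ → EuclideanSpace ℝ (Fin n)) (hxc : ContinuousOn x (Icc (0 : ℝ) T))
    (hx : ∀ t ∈ Icc (0 : ℝ) T,
      x t = x 0 + (∫ s in (0 : ℝ)..t, f s (x s)) + Matrix.toEuclideanLin G (w t))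
    (φ φ' η η' : ℝ → EuclideanSpace ℝ (Fin n))
    (hφ : IsCM T φ φ') (hη : IsCM T η η') (hη0 : η 0 = 0)
    (hode : ∀ᵐ t ∂(volume.restrict (Icc (0 : ℝ) T)),
      φ' t = f t (φ t) + Matrix.toEuclideanLin G (η' t))
    (hinit : ‖x 0 - φ 0‖ ≤ ε)
    (hnoise : ∀ t ∈ Icc (0 : ℝ) T, ‖w t - η t‖ ≤ ε) :
    ∀ t ∈ Icc (0 : ℝ) T, ‖x t - φ t‖ ≤ (1 + matOpNorm G) * Real.exp (T * K) * ε := by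
  intro t ht
  set L := (Matrix.toEuclideanLin G).toContinuousLinearMap
  have hLG : ∀ v, Matrix.toEuclideanLin G v = L v := fun v => rfl
  have hG : 0 ≤ matOpNorm G := norm_nonneg _
  rcases lt_or_ge K 0 with hK | hK
  · have h0 : ‖x t - φ t‖ ≤ 0 :=
      nonpos_of_mul_nonneg_right ((norm_nonneg _).trans (hLip t ht (x t) (φ t))) hK
    exact h0.trans (by positivity)
  have hφc := hφ.continuousOn hT.le
  have hfx : ContinuousOn (fun s => f s (x s)) (Icc 0 T) :=
    hfc.comp_continuousOn (continuousOn_id.prodMk hxc)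
  have hfφ : ContinuousOn (fun s => f s (φ s)) (Icc 0 T) :=
    hfc.comp_continuousOn (continuousOn_id.prodMk hφc)
  have hzc : ContinuousOn (fun s => ‖x s - φ s‖) (Icc 0 T) := (hxc.sub hφc).norm
  have hmain : ∀ r ∈ Icc 0 T,
      ‖x r - φ r‖ ≤ (1 + matOpNorm G) * ε + K * ∫ s in (0 : ℝ)..r, ‖x s - φ s‖ := by
    intro r hr
    have hsub : uIcc 0 r ⊆ Icc 0 T := by
      rw [uIcc_of_le hr.1]
      exact Icc_subset_Icc_right hr.2
    have hsub' : uIcc 0 r ⊆ uIcc 0 T := by rwa [uIcc_of_le hT.le]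
    have ix := (hfx.mono hsub).intervalIntegrable (μ := volume)
    have iφ := (hfφ.mono hsub).intervalIntegrable (μ := volume)
    have iη : IntervalIntegrable η' volume 0 r := hη.1.mono_set hsub'
    have iLη : IntervalIntegrable (fun s => L (η' s)) volume 0 r :=
      ⟨L.integrable_comp iη.1, L.integrable_comp iη.2⟩
    have hφr : φ r = φ 0 + ((∫ s in (0 : ℝ)..r, f s (φ s)) + L (η r)) := by
      rw [hφ.2.1 r hr, hη.2.1 r hr, hη0, zero_add,
        ← L.intervalIntegral_comp_comm iη, ← intervalIntegral.integral_add iφ iLη]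
      congr 1
      refine intervalIntegral.integral_congr_ae ?_
      filter_upwards [(ae_restrict_iff' measurableSet_Icc).1 hode] with s hs hsr
      exact hs (hsub (uIoc_subset_uIcc hsr))
    have hdiff : x r - φ r =
        (x 0 - φ 0) + (∫ s in (0 : ℝ)..r, (f s (x s) - f s (φ s))) + L (w r - η r) := by
      rw [hφr, hx r hr, hLG, intervalIntegral.integral_sub ix iφ, map_sub]
      abel
    have hI : ‖∫ s in (0 : ℝ)..r, (f s (x s) - f s (φ s))‖ ≤
        K * ∫ s in (0 : ℝ)..r, ‖x s - φ s‖ := by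
      rw [← intervalIntegral.integral_const_mul]
      refine intervalIntegral.norm_integral_le_of_norm_le hr.1 (ae_of_all _ fun s hs => ?_)
        ((hzc.mono hsub).intervalIntegrable.const_mul K)
      exact hLip s ⟨hs.1.le, hs.2.trans hr.2⟩ _ _
    have hLw : ‖L (w r - η r)‖ ≤ matOpNorm G * ε :=
      L.le_opNorm_of_le (hnoise r hr)
    rw [hdiff]
    refine norm_add₃_le.trans ?_
    linarith
  calc ‖x t - φ t‖ ≤ (1 + matOpNorm G) * ε * Real.exp (K * t) :=
        le_mul_exp_of_le_add_mul_integral hK hzc hmain t ht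
    _ ≤ (1 + matOpNorm G) * ε * Real.exp (T * K) := by
        rw [mul_comm T K]
        gcongr
        exact ht.2
    _ = (1 + matOpNorm G) * Real.exp (T * K) * ε := by ring
end
end

section
/- Let X be an ℝⁿ-valued random variable whose law is absolutely continuous with respect to Lebesgue measure with a continuous density p_X. Call a point x̂ ∈ ℝⁿ a mode of X if for every x ∈ ℝⁿ, limsup_{ε↓0} P(‖X − x‖ ≤ ε)/P(‖X − x̂‖ ≤ ε) ≤ 1. Then x̂ is a mode of X if and only if p_X(x̂) = sup_{x∈ℝⁿ} p_X(x). -/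
open MeasureTheory Set Filter

/-- At a point of continuity of the density, the mean mass of small closed balls converges
to the density. -/
theorem tendsto_withDensity_closedBall_div {E : Type*} [PseudoMetricSpace E] [MeasurableSpace E]
    [OpensMeasurableSpace E] [ProperSpace E] (μ : Measure E) [μ.IsOpenPosMeasure]
    [IsFiniteMeasureOnCompacts μ] {f : E → ENNReal} {x : E} (hf : ContinuousAt f x)
    (hx : f x ≠ ⊤) :
    Tendsto (fun ε => μ.withDensity f (Metric.closedBall x ε) / μ (Metric.closedBall x ε))
      (nhdsWithin (0 : ℝ) (Ioi 0)) (nhds (f x)) := by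
  rw [ENNReal.tendsto_nhds hx]
  intro δ hδ
  obtain ⟨r, hr, hball⟩ := Metric.eventually_nhds_iff.1 ((ENNReal.tendsto_nhds hx).1 hf δ hδ)
  filter_upwards [Ioo_mem_nhdsGT hr] with ε hε
  have hpos : μ (Metric.closedBall x ε) ≠ 0 := (Metric.measure_closedBall_pos μ x hε.1).ne'
  have hfin : μ (Metric.closedBall x ε) ≠ ⊤ := measure_closedBall_lt_top.ne
  have hmem : ∀ y ∈ Metric.closedBall x ε, f y ∈ Icc (f x - δ) (f x + δ) := fun y hy =>
    hball (lt_of_le_of_lt (Metric.mem_closedBall.1 hy) hε.2)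
  rw [withDensity_apply _ Metric.isClosed_closedBall.measurableSet]
  constructor
  · rw [ENNReal.le_div_iff_mul_le (.inl hpos) (.inl hfin), ← setLIntegral_const]
    exact setLIntegral_mono' Metric.isClosed_closedBall.measurableSet fun y hy => (hmem y hy).1
  · rw [ENNReal.div_le_iff hpos hfin, ← setLIntegral_const]
    exact setLIntegral_mono' Metric.isClosed_closedBall.measurableSet fun y hy => (hmem y hy).2

/-- For an `ℝⁿ`-valued random variable whose law has a continuous density `p` w.r.t.
Lebesgue measure, a point `xhat` is a mode (in the sense that for every `x` the limsup as
`ε ↓ 0` of the ratio of the probabilities of the closed `ε`-balls around `x` and `xhat`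
is at most `1`, with the `ℝ≥0∞` convention that a nonvanishing quantity divided by zero
is `+∞`) if and only if `xhat` maximizes the density `p`. -/
theorem mode_iff_maximizes_density {n : ℕ} {Ω : Type*} [MeasurableSpace Ω]
    (P : Measure Ω) [IsProbabilityMeasure P]
    (X : Ω → EuclideanSpace ℝ (Fin n)) (hX : Measurable X)
    (p : EuclideanSpace ℝ (Fin n) → ℝ) (hp : Continuous p) (hp0 : ∀ x, 0 ≤ p x)
    (hlaw : Measure.map X P = volume.withDensity fun x => ENNReal.ofReal (p x))
    (xhat : EuclideanSpace ℝ (Fin n)) :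
    (∀ x : EuclideanSpace ℝ (Fin n),
        Filter.limsup
          (fun ε => P {ω | ‖X ω - x‖ ≤ ε} / P {ω | ‖X ω - xhat‖ ≤ ε})
          (nhdsWithin (0 : ℝ) (Ioi 0)) ≤ 1) ↔
      (∀ x, p x ≤ p xhat) := by
  have hprob (x : EuclideanSpace ℝ (Fin n)) (ε : ℝ) : P {ω | ‖X ω - x‖ ≤ ε} =
      volume.withDensity (fun x => ENNReal.ofReal (p x)) (Metric.closedBall x ε) := by
    rw [← hlaw, Measure.map_apply hX Metric.isClosed_closedBall.measurableSet]
    simp only [preimage, Metric.mem_closedBall, dist_eq_norm]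
  have hlimsup (x : EuclideanSpace ℝ (Fin n)) (h : p x ≠ 0 ∨ p xhat ≠ 0) :
      limsup (fun ε => P {ω | ‖X ω - x‖ ≤ ε} / P {ω | ‖X ω - xhat‖ ≤ ε})
        (nhdsWithin (0 : ℝ) (Ioi 0)) = ENNReal.ofReal (p x) / ENNReal.ofReal (p xhat) := by
    have hmean (y : EuclideanSpace ℝ (Fin n)) :=
      tendsto_withDensity_closedBall_div volume
        (ENNReal.continuous_ofReal.comp hp).continuousAt (x := y) ENNReal.ofReal_ne_top
    have hne (y : EuclideanSpace ℝ (Fin n)) (hy : p y ≠ 0) : ENNReal.ofReal (p y) ≠ 0 :=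
      (ENNReal.ofReal_pos.2 ((hp0 y).lt_of_ne' hy)).ne'
    refine Tendsto.limsup_eq (Tendsto.congr' ?_ (ENNReal.Tendsto.div (hmean x)
      (h.imp (hne x) (hne xhat)) (hmean xhat) (.inl ENNReal.ofReal_ne_top)))
    filter_upwards [self_mem_nhdsWithin] with ε hε
    have hpos : volume (Metric.closedBall xhat ε) ≠ 0 :=
      (Metric.measure_closedBall_pos volume xhat hε).ne'
    have hfin : volume (Metric.closedBall xhat ε) ≠ ⊤ := measure_closedBall_lt_top.ne
    rw [hprob, hprob, Measure.addHaar_closedBall_center volume x,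
      ← Measure.addHaar_closedBall_center volume xhat]
    simp only [div_eq_mul_inv]
    exact ENNReal.mul_div_mul_right _ _ (ENNReal.inv_ne_zero.2 hfin) (ENNReal.inv_ne_top.2 hpos)
  constructor
  · intro hmode x
    by_contra! hlt
    have hx : 0 < p x := (hp0 xhat).trans_lt hlt
    have hle := hmode x
    rw [hlimsup x (.inl hx.ne'), ENNReal.div_le_iff_le_mul (.inr ENNReal.one_ne_top)
      (.inl ENNReal.ofReal_ne_top), one_mul, ENNReal.ofReal_le_ofReal_iff (hp0 xhat)] at hle
    exact hlt.not_ge hle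
  · intro hmax x
    have hxhat : p xhat ≠ 0 := by
      intro h0
      have hzero (y : EuclideanSpace ℝ (Fin n)) : p y = 0 :=
        le_antisymm ((hmax y).trans_eq h0) (hp0 y)
      have := Measure.isProbabilityMeasure_map (μ := P) hX.aemeasurable
      apply IsProbabilityMeasure.ne_zero (Measure.map X P)
      simp [hlaw, hzero]
    rw [hlimsup x (.inr hxhat)]
    exact ENNReal.div_le_of_le_mul (by simpa using ENNReal.ofReal_le_ofReal (hmax x))
end

section
/- Let f:[0,T]×ℝⁿ→ℝⁿ be continuous with x↦f(t,x) continuously differentiable for each t and with ‖∇_x f(t,x)‖ ≤ K for all (t,x), let G ∈ ℝ^{n×n} be invertible, and let 0 = t_0 < t_1 < … < t_N = T with δ_k := t_{k+1} − t_k and δ_k·K/2 < 1 for all k. Define Ψ:ℝ^{(N+1)n}→ℝ^{(N+1)n} by Ψ(x_0, x_1, …, x_N) = (x_0, w_0, …, w_{N−1}) where w_k := G⁻¹(x_{k+1} − x_k − (δ_k/2)(f(t_k,x_k) + f(t_{k+1},x_{k+1}))). Then Ψ is a bijection, Ψ and Ψ⁻¹ are continuously differentiable, and the Jacobian determinant of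 Ψ at (x_0,…,x_N) equals (det G)^{−N}·∏_{k=0}^{N−1} det(I − (δ_k/2)∇_x f(t_{k+1}, x_{k+1})). -/
noncomputable section

/-- The trapezoidal change of variables
`Ψ : (x₀, …, x_N) ↦ (x₀, w₀, …, w_{N-1})`, where
`w_k = G⁻¹(x_{k+1} - x_k - (δ_k/2)(f(t_k,x_k) + f(t_{k+1},x_{k+1})))`. -/
def trapMap {n : ℕ} (N : ℕ) (f : ℝ → EuclideanSpace ℝ (Fin n) → EuclideanSpace ℝ (Fin n))
    (G : Matrix (Fin n) (Fin n) ℝ) (t : ℕ → ℝ)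
    (x : Fin (N + 1) → EuclideanSpace ℝ (Fin n)) : Fin (N + 1) → EuclideanSpace ℝ (Fin n) :=
  fun k =>
    Fin.cases (motive := fun _ : Fin (N + 1) => EuclideanSpace ℝ (Fin n)) (x 0)
      (fun j => Matrix.toEuclideanLin G⁻¹
        (x j.succ - x j.castSucc -
          (((t ((j : ℕ) + 1) - t (j : ℕ)) / 2) •
            (f (t (j : ℕ)) (x j.castSucc) + f (t ((j : ℕ) + 1)) (x j.succ)))))
      k

/-- Subtracting a contraction from the identity of a Banach space gives a bijection. -/
theorem LipschitzWith.bijective_id_sub {E : Type*} [NormedAddCommGroup E] [CompleteSpace E]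
    {g : E → E} {c : NNReal} (hg : LipschitzWith c g) (hc : c < 1) :
    Function.Bijective fun x => x - g x := by
  refine Function.bijective_iff_existsUnique _ |>.2 fun y => ?_
  have hy : ContractingWith c fun x => y + g x :=
    ⟨hc, LipschitzWith.of_dist_le_mul fun a b => by simpa using hg.dist_le_mul a b⟩
  refine ⟨hy.fixedPoint, ?_, fun x hx => hy.fixedPoint_unique ?_⟩
  · exact sub_eq_iff_eq_add.2 hy.fixedPoint_isFixedPt.symm
  · exact (sub_eq_iff_eq_add.1 hx).symm

/-- Subtracting an endomorphism of norm less than one from the identity gives an invertible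
endomorphism. -/
theorem LinearMap.det_id_sub_ne_zero {E : Type*} [NormedAddCommGroup E] [NormedSpace ℝ E]
    [FiniteDimensional ℝ E] (B : E →L[ℝ] E) (hB : ‖B‖ < 1) :
    LinearMap.det (LinearMap.id - B.toLinearMap) ≠ 0 := by
  rw [Ne, LinearMap.det_eq_zero_iff_ker_ne_bot, not_not, LinearMap.ker_eq_bot']
  intro v hv
  have hv' : v = B v := by simpa [sub_eq_zero] using hv
  have hle : ‖v‖ ≤ ‖B‖ * ‖v‖ := by simpa [← hv'] using B.le_opNorm v
  by_contra h0
  nlinarith [norm_pos_iff.2 h0]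

/-- The determinant of a block lower triangular endomorphism of a finite power of a module is the
product of the determinants of its diagonal blocks. -/
theorem LinearMap.det_of_block_lowerTriangular {ι R M : Type*} [Fintype ι] [LinearOrder ι]
    [CommRing R] [AddCommGroup M] [Module R M] [Module.Free R M] [Module.Finite R M]
    (L : (ι → M) →ₗ[R] (ι → M)) (hL : ∀ i j, i < j → ∀ v, L (Pi.single j v) i = 0) :
    LinearMap.det L =
      ∏ i, LinearMap.det (LinearMap.proj i ∘ₗ L ∘ₗ LinearMap.single R (fun _ => M) i) := by
  classical
  let b := Module.Free.chooseBasis R M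
  let B := Pi.basis (fun _ : ι => b)
  have htri : (LinearMap.toMatrix B B L).BlockTriangular (OrderDual.toDual ∘ Sigma.fst) := by
    rintro ⟨i, a⟩ ⟨j, c⟩ hij
    have hij : i < j := hij
    simp [LinearMap.toMatrix_apply, B, Pi.basis_apply, Pi.basis_repr, hL i j hij]
  rw [← LinearMap.det_toMatrix B, htri.det_fintype, ← OrderDual.toDual.prod_comp]
  refine Finset.prod_congr rfl fun i _ => ?_
  rw [← LinearMap.det_toMatrix b]
  let e : Module.Free.ChooseBasisIndex R M ≃
      {p : Σ _ : ι, Module.Free.ChooseBasisIndex R M //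
        (OrderDual.toDual ∘ Sigma.fst) p = OrderDual.toDual i} :=
    { toFun := fun a => ⟨⟨i, a⟩, rfl⟩
      invFun := fun p => p.1.2
      left_inv := fun _ => rfl
      right_inv := by
        rintro ⟨⟨j, a⟩, h⟩
        obtain rfl : j = i := h
        rfl }
  rw [← Matrix.det_submatrix_equiv_self e]
  congr 1
  ext a c
  simp [LinearMap.toMatrix_apply, B, e, Matrix.toSquareBlock_def, Pi.basis_apply, Pi.basis_repr]

/-- A bijective `C¹` map of finite-dimensional spaces whose derivative is everywhere invertible has
a `C¹` inverse. -/
theorem ContDiff.invFun_of_bijective {E : Type*} [NormedAddCommGroup E] [NormedSpace ℝ E]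
    [FiniteDimensional ℝ E] {F : E → E} (hF : ContDiff ℝ 1 F) (hb : Function.Bijective F)
    (hdet : ∀ x, (fderiv ℝ F x).det ≠ 0) : ContDiff ℝ 1 (Function.invFun F) := by
  have : CompleteSpace E := FiniteDimensional.complete ℝ E
  have hs : ∀ x, HasStrictFDerivAt F
      ((fderiv ℝ F x).toContinuousLinearEquivOfDetNeZero (hdet x) : E →L[ℝ] E) x := fun x => by
    simpa using hF.contDiffAt.hasStrictFDerivAt one_ne_zero
  let h := (Equiv.ofBijective F hb).toHomeomorphOfContinuousOpen hF.continuous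
    (isOpenMap_of_hasStrictFDerivAt_equiv hs)
  have hsymm : Function.invFun F = h.symm := by
    funext y
    apply hb.1
    rw [Function.rightInverse_invFun hb.2 y]
    exact (h.apply_symm_apply y).symm
  rw [hsymm]
  exact h.contDiff_symm (fun x => (hs x).hasFDerivAt) hF

section TrapMap

variable {n N : ℕ} {f : ℝ → EuclideanSpace ℝ (Fin n) → EuclideanSpace ℝ (Fin n)}
  {G : Matrix (Fin n) (Fin n) ℝ} {t : ℕ → ℝ}

theorem trapMap_zero (x : Fin (N + 1) → EuclideanSpace ℝ (Fin n)) :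
    trapMap N f G t x 0 = x 0 := rfl

theorem trapMap_succ (x : Fin (N + 1) → EuclideanSpace ℝ (Fin n)) (j : Fin N) :
    trapMap N f G t x j.succ = Matrix.toEuclideanLin G⁻¹
        (x j.succ - x j.castSucc -
          (((t ((j : ℕ) + 1) - t (j : ℕ)) / 2) •
            (f (t (j : ℕ)) (x j.castSucc) + f (t ((j : ℕ) + 1)) (x j.succ)))) := rfl

/-- If every implicit step is uniquely solvable, then the trapezoidal map is bijective. -/
theorem trapMap_bijective (hG : IsUnit G.det)
    (hstep : ∀ j : Fin N, Function.Bijective fun v =>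
      v - ((t ((j : ℕ) + 1) - t (j : ℕ)) / 2) • f (t ((j : ℕ) + 1)) v) :
    Function.Bijective (trapMap N f G t) := by
  have hGb : Function.Bijective (Matrix.toEuclideanLin G⁻¹) := by
    have hu : IsUnit (LinearMap.det (Matrix.toEuclideanLin G⁻¹)) := by
      simpa [Matrix.det_nonsing_inv] using hG
    exact (Module.End.isUnit_iff _).1 ((LinearMap.isUnit_iff_isUnit_det _).2 hu)
  have hsplit : ∀ (j : Fin N) (u v : EuclideanSpace ℝ (Fin n)),
      v - u - ((t ((j : ℕ) + 1) - t (j : ℕ)) / 2) • (f (t (j : ℕ)) u + f (t ((j : ℕ) + 1)) v) =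
        (v - ((t ((j : ℕ) + 1) - t (j : ℕ)) / 2) • f (t ((j : ℕ) + 1)) v) -
          (u + ((t ((j : ℕ) + 1) - t (j : ℕ)) / 2) • f (t (j : ℕ)) u) := fun j u v => by
    module
  constructor
  · intro x y hxy
    funext k
    induction k using Fin.induction with
    | zero => exact congrFun hxy 0
    | succ j ih =>
      have h := hGb.1 (congrFun hxy j.succ)
      rw [hsplit, hsplit, ih] at h
      exact (hstep j).1 (sub_left_injective h)
  · intro y
    have hex : ∀ (j : Fin N) (u : EuclideanSpace ℝ (Fin n)), ∃ v, Matrix.toEuclideanLin G⁻¹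
        (v - u - ((t ((j : ℕ) + 1) - t (j : ℕ)) / 2) •
          (f (t (j : ℕ)) u + f (t ((j : ℕ) + 1)) v)) = y j.succ := fun j u => by
      obtain ⟨w, hw⟩ := hGb.2 (y j.succ)
      obtain ⟨v, hv⟩ := (hstep j).2
        (w + (u + ((t ((j : ℕ) + 1) - t (j : ℕ)) / 2) • f (t (j : ℕ)) u))
      refine ⟨v, ?_⟩
      simp only at hv
      rw [hsplit, hv, add_sub_cancel_right, hw]
    choose s hs using hex
    refine ⟨fun k => Fin.induction (motive := fun _ => EuclideanSpace ℝ (Fin n)) (y 0) s k, ?_⟩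
    funext k
    cases k using Fin.cases with
    | zero => rfl
    | succ j =>
      rw [trapMap_succ]
      exact hs j _

theorem contDiff_trapMap (hf : ∀ s, ContDiff ℝ 1 (f s)) : ContDiff ℝ 1 (trapMap N f G t) := by
  refine contDiff_pi.2 fun k => ?_
  cases k using Fin.cases with
  | zero => exact contDiff_apply ℝ _ 0
  | succ j =>
    have hs := contDiff_apply (n := 1) ℝ (EuclideanSpace ℝ (Fin n)) j.succ
    have hc := contDiff_apply (n := 1) ℝ (EuclideanSpace ℝ (Fin n)) j.castSucc
    exact (LinearMap.toContinuousLinearMap (Matrix.toEuclideanLin G⁻¹)).contDiff.comp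
      ((hs.sub hc).sub ((((hf _).comp hc).add ((hf _).comp hs)).const_smul _))

theorem fderiv_trapMap_zero (hf : ∀ s, ContDiff ℝ 1 (f s))
    (x v : Fin (N + 1) → EuclideanSpace ℝ (Fin n)) :
    fderiv ℝ (trapMap N f G t) x v 0 = v 0 := by
  have hd := hasFDerivAt_pi'.1
    ((contDiff_trapMap (N := N) (G := G) (t := t) hf).differentiable one_ne_zero x).hasFDerivAt 0
  exact DFunLike.congr_fun (hd.unique (ContinuousLinearMap.proj
    (R := ℝ) (φ := fun _ : Fin (N + 1) => EuclideanSpace ℝ (Fin n)) 0).hasFDerivAt) v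

theorem fderiv_trapMap_succ (hf : ∀ s, ContDiff ℝ 1 (f s))
    (x v : Fin (N + 1) → EuclideanSpace ℝ (Fin n)) (j : Fin N) :
    fderiv ℝ (trapMap N f G t) x v j.succ = Matrix.toEuclideanLin G⁻¹
        (v j.succ - v j.castSucc -
          (((t ((j : ℕ) + 1) - t (j : ℕ)) / 2) •
            (fderiv ℝ (f (t (j : ℕ))) (x j.castSucc) (v j.castSucc) +
              fderiv ℝ (f (t ((j : ℕ) + 1))) (x j.succ) (v j.succ)))) := by
  have hd := hasFDerivAt_pi'.1
    ((contDiff_trapMap (N := N) (G := G) (t := t) hf).differentiable one_ne_zero x).hasFDerivAt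
      j.succ
  have hs := (ContinuousLinearMap.proj (R := ℝ)
    (φ := fun _ : Fin (N + 1) => EuclideanSpace ℝ (Fin n)) j.succ).hasFDerivAt (x := x)
  have hc := (ContinuousLinearMap.proj (R := ℝ)
    (φ := fun _ : Fin (N + 1) => EuclideanSpace ℝ (Fin n)) j.castSucc).hasFDerivAt (x := x)
  have hfd : ∀ s u, HasFDerivAt (f s) (fderiv ℝ (f s) u) u := fun s u =>
    ((hf s).differentiable one_ne_zero u).hasFDerivAt
  exact DFunLike.congr_fun (hd.unique
    ((LinearMap.toContinuousLinearMap (Matrix.toEuclideanLin G⁻¹)).hasFDerivAt.comp x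
      ((hs.sub hc).sub ((((hfd _ _).comp x hc).add ((hfd _ _).comp x hs)).const_smul
        ((t ((j : ℕ) + 1) - t (j : ℕ)) / 2))))) v

theorem det_fderiv_trapMap (hf : ∀ s, ContDiff ℝ 1 (f s))
    (x : Fin (N + 1) → EuclideanSpace ℝ (Fin n)) :
    LinearMap.det (fderiv ℝ (trapMap N f G t) x).toLinearMap =
      (G.det)⁻¹ ^ N *
        ∏ k : Fin N,
          LinearMap.det
            ((LinearMap.id : EuclideanSpace ℝ (Fin n) →ₗ[ℝ] EuclideanSpace ℝ (Fin n)) -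
              ((t ((k : ℕ) + 1) - t (k : ℕ)) / 2) •
                (fderiv ℝ (f (t ((k : ℕ) + 1))) (x k.succ)).toLinearMap) := by
  rw [LinearMap.det_of_block_lowerTriangular, Fin.prod_univ_succ]
  · have h0 : LinearMap.proj 0 ∘ₗ (fderiv ℝ (trapMap N f G t) x).toLinearMap ∘ₗ
        LinearMap.single ℝ (fun _ => EuclideanSpace ℝ (Fin n)) 0 = LinearMap.id :=
      LinearMap.ext fun v => by simp [fderiv_trapMap_zero hf]
    have hsucc : ∀ j : Fin N,
        LinearMap.proj j.succ ∘ₗ (fderiv ℝ (trapMap N f G t) x).toLinearMap ∘ₗ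
          LinearMap.single ℝ (fun _ => EuclideanSpace ℝ (Fin n)) j.succ =
        Matrix.toEuclideanLin G⁻¹ ∘ₗ (LinearMap.id - ((t ((j : ℕ) + 1) - t (j : ℕ)) / 2) •
          (fderiv ℝ (f (t ((j : ℕ) + 1))) (x j.succ)).toLinearMap) := fun j =>
      LinearMap.ext fun v => by
        have hne : j.castSucc ≠ j.succ := Fin.castSucc_lt_succ.ne
        simp [fderiv_trapMap_succ hf, Pi.single_eq_of_ne hne]
    simp only [h0, hsucc, LinearMap.det_id, LinearMap.det_comp, LinearMap.det_toLpLin, one_mul,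
      Finset.prod_mul_distrib, Finset.prod_const, Finset.card_univ, Fintype.card_fin,
      Matrix.det_nonsing_inv, Ring.inverse_eq_inv']
  · intro i j hij v
    cases i using Fin.cases with
    | zero => simp [fderiv_trapMap_zero hf, Pi.single_eq_of_ne hij.ne]
    | succ i =>
      have hne : i.castSucc ≠ j := (Fin.castSucc_lt_succ.trans hij).ne
      simp [fderiv_trapMap_succ hf, Pi.single_eq_of_ne hij.ne, Pi.single_eq_of_ne hne]

end TrapMap

/-- The trapezoidal change of variables `Ψ` is a `C¹` diffeomorphism of `ℝ^{(N+1)n}` whose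
Jacobian determinant at `x` is `(det G)⁻ᴺ · ∏ₖ det(I - (δₖ/2)∇ₓf(tₖ₊₁, xₖ₊₁))`. -/
theorem trapezoidal_map_is_diffeomorphism_with_jacobian {n : ℕ} (T K : ℝ) (hT : 0 < T)
    (N : ℕ) (hN : 0 < N) (t : ℕ → ℝ) (ht0 : t 0 = 0) (htN : t N = T)
    (htmono : ∀ k < N, t k < t (k + 1))
    (hstep : ∀ k < N, (t (k + 1) - t k) * K / 2 < 1)
    (f : ℝ → EuclideanSpace ℝ (Fin n) → EuclideanSpace ℝ (Fin n))
    (hfc : Continuous fun p : ℝ × EuclideanSpace ℝ (Fin n) => f p.1 p.2)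
    (hfs : ∀ s, ContDiff ℝ 1 (f s))
    (hfK : ∀ s x, ‖fderiv ℝ (f s) x‖ ≤ K)
    (G : Matrix (Fin n) (Fin n) ℝ) (hG : IsUnit G.det) :
    Function.Bijective (trapMap N f G t) ∧
    ContDiff ℝ 1 (trapMap N f G t) ∧
    ContDiff ℝ 1 (Function.invFun (trapMap N f G t)) ∧
    ∀ x : Fin (N + 1) → EuclideanSpace ℝ (Fin n),
      LinearMap.det (fderiv ℝ (trapMap N f G t) x).toLinearMap =
        (G.det)⁻¹ ^ N *
          ∏ k : Fin N,
            LinearMap.det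
              ((LinearMap.id : EuclideanSpace ℝ (Fin n) →ₗ[ℝ] EuclideanSpace ℝ (Fin n)) -
                ((t ((k : ℕ) + 1) - t (k : ℕ)) / 2) •
                  (fderiv ℝ (f (t ((k : ℕ) + 1))) (x k.succ)).toLinearMap) := by
  have hpos : ∀ k : Fin N, 0 ≤ (t ((k : ℕ) + 1) - t (k : ℕ)) / 2 := fun k =>
    (half_pos (sub_pos.2 (htmono k k.2))).le
  have hlt : ∀ k : Fin N, (t ((k : ℕ) + 1) - t (k : ℕ)) / 2 * K < 1 := fun k => by
    linarith [hstep k k.2]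
  have hbij : Function.Bijective (trapMap N f G t) := by
    refine trapMap_bijective hG fun j => ?_
    have hLip : LipschitzWith (Real.toNNReal ((t ((j : ℕ) + 1) - t (j : ℕ)) / 2 * K))
        fun v => ((t ((j : ℕ) + 1) - t (j : ℕ)) / 2) • f (t ((j : ℕ) + 1)) v := by
      refine LipschitzWith.of_dist_le' fun u v => ?_
      rw [dist_smul₀, Real.norm_of_nonneg (hpos j), mul_assoc, dist_eq_norm, dist_eq_norm]
      refine mul_le_mul_of_nonneg_left ?_ (hpos j)
      exact convex_univ.norm_image_sub_le_of_norm_fderiv_le (𝕜 := ℝ)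
        (fun w _ => (hfs _).differentiable one_ne_zero w) (fun w _ => hfK _ w) trivial trivial
    exact hLip.bijective_id_sub (Real.toNNReal_lt_one.2 (hlt j))
  have hdiff : ContDiff ℝ 1 (trapMap N f G t) := contDiff_trapMap hfs
  refine ⟨hbij, hdiff, hdiff.invFun_of_bijective hbij fun x => ?_, det_fderiv_trapMap hfs⟩
  rw [ContinuousLinearMap.det, det_fderiv_trapMap hfs]
  refine mul_ne_zero (pow_ne_zero _ (inv_ne_zero hG.ne_zero)) (Finset.prod_ne_zero_iff.2 ?_)
  intro k _
  refine LinearMap.det_id_sub_ne_zero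
    (((t ((k : ℕ) + 1) - t (k : ℕ)) / 2) • fderiv ℝ (f (t ((k : ℕ) + 1))) (x k.succ)) ?_
  rw [norm_smul, Real.norm_of_nonneg (hpos k)]
  exact (mul_le_mul_of_nonneg_left (hfK _ _) (hpos k)).trans_lt (hlt k)
end
end
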